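/- Let Γ be a countable group and let α : Γ ↷ X be a standard action such that X admits at least one Γ-invariant probability measure. Then there exists a map β : X → Erg(α) that is an ergodic decomposition of (α, μ) : Γ ↷ X simultaneously for every α-invariant probability measure μ on X. -/

import Mathlib

open MeasureTheory

/-- A measure `ν` on `X` is invariant under the action of the group `Γ`. -/
def IsInvariantMeasure (Γ : Type*) {X : Type*} [Group Γ] [MulAction Γ X]
    [MeasurableSpace X] (ν : Measure X) : Prop :=
  ∀ γ : Γ, Measure.map (fun x : X => γ • x) ν = ν

/-- A measure `ν` on `X` is a `Γ`-invariant ergodic probability measure: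
every measurable `Γ`-invariant set has measure `0` or `1`. -/
def IsErgodicInvariantProb (Γ : Type*) {X : Type*} [Group Γ] [MulAction Γ X]
    [MeasurableSpace X] (ν : Measure X) : Prop :=
  IsProbabilityMeasure ν ∧ IsInvariantMeasure Γ ν ∧
    ∀ A : Set X, MeasurableSet A →
      (∀ γ : Γ, (fun x : X => γ • x) '' A = A) → ν A = 0 ∨ ν A = 1

/-- `β : X → Prob(X)` is an ergodic decomposition of the standard probability action
`(α, μ) : Γ ↷ X`: each `β x` is an ergodic invariant probability measure, evaluation
maps are measurable, `μ` disintegrates as `μ A = ∫ β_x(A) dμ(x)`, `β` is `Γ`-invariant,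
and for every ergodic invariant probability measure `ν` the fibre `β⁻¹(ν)` is
measurable with `ν(β⁻¹(ν)) = 1`. -/
def IsErgodicDecomposition (Γ : Type*) {X : Type*} [Group Γ] [MulAction Γ X]
    [MeasurableSpace X] (μ : Measure X) (β : X → Measure X) : Prop :=
  (∀ x : X, IsErgodicInvariantProb Γ (β x)) ∧
  (∀ A : Set X, MeasurableSet A → Measurable (fun x : X => β x A)) ∧
  (∀ A : Set X, MeasurableSet A → μ A = ∫⁻ x, β x A ∂μ) ∧
  (∀ x : X, ∀ γ : Γ, β (γ • x) = β x) ∧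
  (∀ ν : Measure X, IsErgodicInvariantProb Γ ν →
      MeasurableSet {x : X | β x = ν} ∧ ν {x : X | β x = ν} = 1)


namespace ErgDec

open scoped ENNReal
open Filter Set

set_option linter.unusedSectionVars false
set_option linter.unusedVariables false
set_option linter.style.haveILetI false

lemma limsup_add_le_enn (u v : ℕ → ℝ≥0∞) :
    limsup (fun n => u n + v n) atTop ≤ limsup u atTop + limsup v atTop := by
  rcases eq_or_ne (limsup u atTop) ∞ with h | hu
  · simp [h]
  rcases eq_or_ne (limsup v atTop) ∞ with h | hv
  · simp [h]
  refine ENNReal.le_of_forall_pos_le_add fun ε hε _ => ?_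
  have hε2 : (ε / 2 : ℝ≥0∞) ≠ 0 := by simp [hε.ne']
  have h1 := eventually_lt_of_limsup_lt (ENNReal.lt_add_right hu hε2)
  have h2 := eventually_lt_of_limsup_lt (ENNReal.lt_add_right hv hε2)
  refine limsup_le_of_le (by isBoundedDefault) ?_
  filter_upwards [h1, h2] with n a b
  refine (add_le_add a.le b.le).trans (le_of_eq ?_)
  rw [add_add_add_comm, ENNReal.add_halves]

section Op
variable {Γ X : Type*} [Group Γ] [Countable Γ] [MeasurableSpace Γ] [DiscreteMeasurableSpace Γ]
  [MeasurableSpace X] [MulAction Γ X]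

noncomputable def Pop (p : Measure Γ) (f : X → ℝ≥0∞) (x : X) : ℝ≥0∞ := ∫⁻ γ, f (γ • x) ∂p

noncomputable def Ssum (p : Measure Γ) (f : X → ℝ≥0∞) : ℕ → X → ℝ≥0∞
  | 0 => fun _ => 0
  | n + 1 => fun x => f x + Pop p (Ssum p f n) x

noncomputable def Msum (p : Measure Γ) (f c : X → ℝ≥0∞) : ℕ → X → ℝ≥0∞
  | 0 => fun _ => 0
  | n + 1 => fun x => (f x + Pop p (Msum p f c n) x) - c x

noncomputable def avg (p : Measure Γ) (f : X → ℝ≥0∞) (n : ℕ) (x : X) : ℝ≥0∞ :=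
  Ssum p f (n + 1) x / ((n : ℝ≥0∞) + 1)

noncomputable def gfun (p : Measure Γ) (f : X → ℝ≥0∞) (x : X) : ℝ≥0∞ :=
  limsup (fun n => avg p f n x) atTop

noncomputable def Gfun (p : Measure Γ) (f : X → ℝ≥0∞) (x : X) : ℝ≥0∞ :=
  ⨆ γ : Γ, gfun p f (γ • x)

variable {p : Measure Γ} [IsProbabilityMeasure p]

lemma meas_uncurry (hact : ∀ γ : Γ, Measurable (fun x : X => γ • x)) {f : X → ℝ≥0∞}
    (hf : Measurable f) : Measurable (fun z : X × Γ => f (z.2 • z.1)) :=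
  measurable_from_prod_countable_left fun γ => hf.comp (hact γ)

lemma Pop_meas (hact : ∀ γ : Γ, Measurable (fun x : X => γ • x)) {f : X → ℝ≥0∞}
    (hf : Measurable f) : Measurable (Pop p f) :=
  (meas_uncurry hact hf).lintegral_prod_right'

lemma Pop_mono {f g : X → ℝ≥0∞} (h : ∀ x, f x ≤ g x) (x : X) : Pop p f x ≤ Pop p g x :=
  lintegral_mono fun _ => h _

lemma Pop_add {f g : X → ℝ≥0∞} (x : X) :
    Pop p (fun x => f x + g x) x = Pop p f x + Pop p g x :=
  lintegral_add_left (Measurable.of_discrete) _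

lemma Pop_mul (a : ℝ≥0∞) {f : X → ℝ≥0∞} (x : X) :
    Pop p (fun x => a * f x) x = a * Pop p f x :=
  lintegral_const_mul _ (Measurable.of_discrete)

lemma Pop_inv {c : X → ℝ≥0∞} (hc : ∀ (γ : Γ) x, c (γ • x) = c x) (x : X) :
    Pop p c x = c x := by
  simp [Pop, hc]

lemma Pop_int (hact : ∀ γ : Γ, Measurable (fun x : X => γ • x)) {f : X → ℝ≥0∞}
    (hf : Measurable f) {μ : Measure X} [IsFiniteMeasure μ] (hμ : IsInvariantMeasure Γ μ) :
    ∫⁻ x, Pop p f x ∂μ = ∫⁻ x, f x ∂μ := by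
  unfold Pop
  rw [lintegral_lintegral_swap (meas_uncurry hact hf).aemeasurable]
  have : ∀ γ : Γ, ∫⁻ x, f (γ • x) ∂μ = ∫⁻ x, f x ∂μ := fun γ => by
    rw [← lintegral_map hf (hact γ), hμ γ]
  simp [this]

lemma Ssum_meas (hact : ∀ γ : Γ, Measurable (fun x : X => γ • x)) {f : X → ℝ≥0∞}
    (hf : Measurable f) : ∀ n, Measurable (Ssum p f n)
  | 0 => measurable_const
  | n + 1 => hf.add (Pop_meas hact (Ssum_meas hact hf n))

lemma Msum_meas (hact : ∀ γ : Γ, Measurable (fun x : X => γ • x)) {f c : X → ℝ≥0∞}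
    (hf : Measurable f) (hc : Measurable c) : ∀ n, Measurable (Msum p f c n)
  | 0 => measurable_const
  | n + 1 => (hf.add (Pop_meas hact (Msum_meas hact hf hc n))).sub hc

lemma avg_meas (hact : ∀ γ : Γ, Measurable (fun x : X => γ • x)) {f : X → ℝ≥0∞}
    (hf : Measurable f) (n : ℕ) : Measurable (avg p f n) :=
  (Ssum_meas hact hf _).div_const _

lemma gfun_meas (hact : ∀ γ : Γ, Measurable (fun x : X => γ • x)) {f : X → ℝ≥0∞}
    (hf : Measurable f) : Measurable (gfun p f) :=
  Measurable.limsup fun n => avg_meas hact hf n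

lemma Gfun_meas (hact : ∀ γ : Γ, Measurable (fun x : X => γ • x)) {f : X → ℝ≥0∞}
    (hf : Measurable f) : Measurable (Gfun p f) :=
  Measurable.iSup fun γ => (gfun_meas hact hf).comp (hact γ)

lemma Gfun_inv (f : X → ℝ≥0∞) (γ : Γ) (x : X) : Gfun p f (γ • x) = Gfun p f x := by
  unfold Gfun
  simp_rw [smul_smul]
  exact (Equiv.mulRight γ).iSup_comp (g := fun δ => gfun p f (δ • x))

lemma Ssum_le {f : X → ℝ≥0∞} (hf : ∀ x, f x ≤ 1) : ∀ n x, Ssum p f n x ≤ n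
  | 0, x => by simp [Ssum]
  | n + 1, x => by
    have : Pop p (Ssum p f n) x ≤ n := by
      refine (Pop_mono (g := fun _ => (n : ℝ≥0∞)) (Ssum_le hf n) x).trans ?_
      simp [Pop]
    calc _ ≤ 1 + (n : ℝ≥0∞) := add_le_add (hf x) this
      _ = _ := by push_cast; ring

lemma Msum_le {f c : X → ℝ≥0∞} (hf : ∀ x, f x ≤ 1) : ∀ n x, Msum p f c n x ≤ n
  | 0, x => by simp [Msum]
  | n + 1, x => by
    have : Pop p (Msum p f c n) x ≤ n := by
      refine (Pop_mono (g := fun _ => (n : ℝ≥0∞)) (Msum_le hf n) x).trans ?_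
      simp [Pop]
    calc _ ≤ f x + Pop p (Msum p f c n) x := tsub_le_self
      _ ≤ 1 + (n : ℝ≥0∞) := add_le_add (hf x) this
      _ = _ := by push_cast; ring

lemma Msum_mono {f c : X → ℝ≥0∞} : ∀ n x, Msum p f c n x ≤ Msum p f c (n + 1) x
  | 0, x => by simp [Msum]
  | n + 1, x => tsub_le_tsub_right (add_le_add le_rfl (Pop_mono (Msum_mono n) x)) _

lemma avg_le {f : X → ℝ≥0∞} (hf : ∀ x, f x ≤ 1) (n : ℕ) (x : X) : avg p f n x ≤ 1 := by
  unfold avg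
  refine ENNReal.div_le_of_le_mul ?_
  simpa using Ssum_le (p := p) hf (n + 1) x

lemma gfun_le {f : X → ℝ≥0∞} (hf : ∀ x, f x ≤ 1) (x : X) : gfun p f x ≤ 1 :=
  limsup_le_of_le (by isBoundedDefault) (Eventually.of_forall fun n => avg_le hf n x)

lemma Gfun_le {f : X → ℝ≥0∞} (hf : ∀ x, f x ≤ 1) (x : X) : Gfun p f x ≤ 1 :=
  iSup_le fun _ => gfun_le hf _

lemma Ssum_le_Msum {f c : X → ℝ≥0∞} (hc : ∀ (γ : Γ) x, c (γ • x) = c x) :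
    ∀ n x, Ssum p f n x ≤ Msum p f c n x + n * c x
  | 0, x => by simp [Ssum]
  | n + 1, x => by
    have h1 : Pop p (Ssum p f n) x ≤ Pop p (Msum p f c n) x + n * c x := by
      refine (Pop_mono (Ssum_le_Msum hc n) x).trans ?_
      rw [Pop_add, Pop_mul, Pop_inv hc]
    calc f x + Pop p (Ssum p f n) x ≤ f x + (Pop p (Msum p f c n) x + n * c x) :=
          add_le_add le_rfl h1
      _ = (f x + Pop p (Msum p f c n) x) + n * c x := by ring
      _ ≤ (Msum p f c (n + 1) x + c x) + n * c x := add_le_add le_tsub_add le_rfl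
      _ = _ := by push_cast; ring

/-- maximal ergodic inequality -/
lemma maximal (hact : ∀ γ : Γ, Measurable (fun x : X => γ • x)) {f c : X → ℝ≥0∞}
    (hf : Measurable f) (hc : Measurable c) (hf1 : ∀ x, f x ≤ 1)
    {μ : Measure X} [IsFiniteMeasure μ] (hμ : IsInvariantMeasure Γ μ) (n : ℕ) :
    ∫⁻ x in {x | 0 < Msum p f c n x}, c x ∂μ ≤ ∫⁻ x, f x ∂μ := by
  rcases n with _ | n
  · simp [Msum]
  set M := Msum p f c (n + 1) with hM
  have hMm : Measurable M := Msum_meas hact hf hc _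
  set D := {x | 0 < M x} with hD
  have hDm : MeasurableSet D := measurableSet_lt measurable_const hMm
  have hfin : ∫⁻ x, M x ∂μ ≠ ∞ := by
    refine ne_top_of_le_ne_top ?_ (lintegral_mono (Msum_le (p := p) (c := c) hf1 (n + 1)))
    simp [ENNReal.mul_eq_top]
  have hDM : ∫⁻ x in D, M x ∂μ = ∫⁻ x, M x ∂μ := by
    apply setLIntegral_eq_of_support_subset
    intro x hx
    exact pos_iff_ne_zero.2 hx
  have key : ∫⁻ x in D, (c x + M x) ∂μ ≤ ∫⁻ x in D, (f x + Pop p M x) ∂μ := by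
    refine setLIntegral_mono (hf.add (Pop_meas hact hMm)) fun x hx => ?_
    have hx' : 0 < (f x + Pop p (Msum p f c n) x) - c x := hx
    have : c x + M x = f x + Pop p (Msum p f c n) x :=
      add_tsub_cancel_of_le (tsub_pos_iff_lt.1 hx').le
    rw [this]
    exact add_le_add le_rfl (Pop_mono (Msum_mono n) x)
  rw [lintegral_add_left hc, lintegral_add_left hf, hDM] at key
  have h2 : ∫⁻ x in D, Pop p M x ∂μ ≤ ∫⁻ x, M x ∂μ := by
    rw [← Pop_int (p := p) hact hMm hμ]
    exact setLIntegral_le_lintegral _ _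
  have h3 : ∫⁻ x in D, f x ∂μ ≤ ∫⁻ x, f x ∂μ := setLIntegral_le_lintegral _ _
  exact (ENNReal.add_le_add_iff_right hfin).1 (key.trans (add_le_add h3 h2))

lemma gfun_le_Pop (hact : ∀ γ : Γ, Measurable (fun x : X => γ • x)) {f : X → ℝ≥0∞}
    (hf : Measurable f) (hf1 : ∀ x, f x ≤ 1) (x : X) : gfun p f x ≤ Pop p (gfun p f) x := by
  have h1 : limsup (fun n => Pop p (avg p f n) x) atTop ≤ Pop p (gfun p f) x :=
    limsup_lintegral_le (fun _ => 1) (fun n => Measurable.of_discrete)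
      (fun n => Eventually.of_forall fun γ => avg_le hf1 n _) (by simp)
  have h2 : ∀ n, avg p f (n + 1) x ≤ ((n + 1 : ℕ) : ℝ≥0∞)⁻¹ + Pop p (avg p f n) x := by
    intro n
    have e : Pop p (avg p f n) x = Pop p (Ssum p f (n + 1)) x / ((n : ℝ≥0∞) + 1) := by
      have := Pop_mul (p := p) (((n : ℝ≥0∞) + 1)⁻¹) (f := Ssum p f (n + 1)) x
      rw [ENNReal.div_eq_inv_mul, ← this]
      congr 1
      funext y
      simp [avg, ENNReal.div_eq_inv_mul]
    rw [e]
    change (f x + Pop p (Ssum p f (n + 1)) x) / (((n + 1 : ℕ) : ℝ≥0∞) + 1) ≤ _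
    calc _ ≤ (f x + Pop p (Ssum p f (n + 1)) x) / ((n : ℝ≥0∞) + 1) := by
          apply ENNReal.div_le_div_left
          push_cast
          exact le_self_add
      _ ≤ (1 + Pop p (Ssum p f (n + 1)) x) / ((n : ℝ≥0∞) + 1) := by
          apply ENNReal.div_le_div_right
          exact add_le_add (hf1 x) le_rfl
      _ = _ := by rw [ENNReal.add_div, one_div]; push_cast; rfl
  have h3 : gfun p f x = limsup (fun n => avg p f (n + 1) x) atTop :=
    (limsup_nat_add (fun n => avg p f n x) 1).symm
  rw [h3]
  refine (limsup_le_limsup (Eventually.of_forall h2)).trans ?_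
  refine (limsup_add_le_enn _ _).trans ?_
  have h4 : limsup (fun n : ℕ => ((n + 1 : ℕ) : ℝ≥0∞)⁻¹) atTop = 0 :=
    ((tendsto_add_atTop_iff_nat 1).2 ENNReal.tendsto_inv_nat_nhds_zero).limsup_eq
  rw [h4, zero_add]
  exact h1

lemma gfun_ae (hact : ∀ γ : Γ, Measurable (fun x : X => γ • x))
    (hp : ∀ γ : Γ, p {γ} ≠ 0) {f : X → ℝ≥0∞}
    (hf : Measurable f) (hf1 : ∀ x, f x ≤ 1) {μ : Measure X} [IsFiniteMeasure μ]
    (hμ : IsInvariantMeasure Γ μ) : ∀ᵐ x ∂μ, Gfun p f x ≤ gfun p f x := by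
  have hg := gfun_meas (p := p) hact hf
  have h1 : ∀ t : ℚ, ∀ᵐ x ∂μ, gfun p f x ≤ ((Real.toNNReal t : NNReal) : ℝ≥0∞) →
      ∀ γ : Γ, gfun p f (γ • x) ≤ ((Real.toNNReal t : NNReal) : ℝ≥0∞) := by
    intro q
    set t : ℝ≥0∞ := ((Real.toNNReal q : NNReal) : ℝ≥0∞)
    set u : X → ℝ≥0∞ := fun x => gfun p f x - t with hu
    have hum : Measurable u := hg.sub_const t
    have hle : ∀ x, u x ≤ Pop p u x := by
      intro x
      refine tsub_le_iff_right.2 ((gfun_le_Pop hact hf hf1 x).trans ?_)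
      calc Pop p (gfun p f) x ≤ Pop p (fun x => u x + t) x := Pop_mono (fun y => le_tsub_add) x
        _ = Pop p u x + t := by rw [Pop_add]; simp [Pop]
    have hfin : ∫⁻ x, u x ∂μ ≠ ∞ := by
      refine ne_top_of_le_ne_top ?_
        (lintegral_mono (g := fun _ => 1) fun x => tsub_le_self.trans (gfun_le hf1 x))
      simp
    have := ae_eq_of_ae_le_of_lintegral_le (Eventually.of_forall hle) hfin
      (Pop_meas hact hum).aemeasurable (Pop_int hact hum hμ).le
    filter_upwards [this] with x hx hxt γ
    have h0 : u x = 0 := tsub_eq_zero_of_le hxt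
    rw [h0] at hx
    have h2 := (lintegral_eq_zero_iff (μ := p) (f := fun γ => u (γ • x)) Measurable.of_discrete).1 hx.symm
    have h3 : u (γ • x) = 0 := by
      by_contra hne
      refine hp γ (measure_mono_null ?_ (ae_iff.1 h2))
      rintro _ rfl
      exact hne
    exact tsub_eq_zero_iff_le.1 h3
  filter_upwards [ae_all_iff.2 h1] with x hx
  refine iSup_le fun γ => ?_
  by_contra hlt
  obtain ⟨q, -, h2, h3⟩ := ENNReal.lt_iff_exists_rat_btwn.1 (not_le.1 hlt)
  exact absurd (hx q h2.le γ) (not_le.2 h3)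

lemma Gfun_int_le (hact : ∀ γ : Γ, Measurable (fun x : X => γ • x))
    (hp : ∀ γ : Γ, p {γ} ≠ 0) {f : X → ℝ≥0∞}
    (hf : Measurable f) (hf1 : ∀ x, f x ≤ 1) {μ : Measure X} [IsFiniteMeasure μ]
    (hμ : IsInvariantMeasure Γ μ) : ∫⁻ x, Gfun p f x ∂μ ≤ ∫⁻ x, f x ∂μ := by
  have hG := Gfun_meas (p := p) hact hf
  have key : ∀ ε : ℝ≥0∞, ε ≠ 0 → ∫⁻ x, Gfun p f x ∂μ ≤ ∫⁻ x, f x ∂μ + ε * μ univ := by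
    intro ε hε
    set c : X → ℝ≥0∞ := fun x => Gfun p f x - ε with hc
    have hcm : Measurable c := hG.sub_const ε
    have hci : ∀ (γ : Γ) x, c (γ • x) = c x := fun γ x => by simp [hc, Gfun_inv]
    have h1 : ∫⁻ x, Gfun p f x ∂μ ≤ ∫⁻ x, c x ∂μ + ε * μ univ := by
      rw [← lintegral_const, ← lintegral_add_left hcm]
      exact lintegral_mono fun x => le_tsub_add
    refine h1.trans (add_le_add ?_ le_rfl)
    set D : ℕ → Set X := fun n => {x | 0 < Msum p f c n x} with hD
    have hmono : Monotone D := monotone_nat_of_le_succ fun n x hx =>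
      lt_of_lt_of_le hx (Msum_mono n x)
    have h2 : ∫⁻ x, c x ∂μ ≤ ∫⁻ x in ⋃ n, D n, c x ∂μ := by
      rw [← lintegral_indicator
        (MeasurableSet.iUnion fun n => measurableSet_lt measurable_const (Msum_meas hact hf hcm n))]
      refine lintegral_mono_ae ?_
      filter_upwards [gfun_ae hact hp hf hf1 hμ] with x hx
      by_cases hxD : x ∈ ⋃ n, D n
      · rw [indicator_of_mem hxD]
      rw [indicator_of_notMem hxD, nonpos_iff_eq_zero]
      by_contra hne
      have hlt : c x < gfun p f x := by
        refine lt_of_lt_of_le ?_ hx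
        have hG0 : Gfun p f x ≠ 0 := fun h => hne (by simp [hc, h])
        exact ENNReal.sub_lt_self (ne_top_of_le_ne_top ENNReal.one_ne_top (Gfun_le hf1 x)) hG0 hε
      obtain ⟨n, hn⟩ := (frequently_lt_of_lt_limsup (by isBoundedDefault) hlt).exists
      apply hxD
      refine mem_iUnion.2 ⟨n + 1, ?_⟩
      by_contra h0
      have h0' : Msum p f c (n + 1) x = 0 := by simpa [hD] using h0
      have h3 := Ssum_le_Msum (p := p) (f := f) hci (n + 1) x
      rw [h0', zero_add] at h3
      refine absurd hn (not_lt.2 ?_)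
      refine ENNReal.div_le_of_le_mul ?_
      rw [mul_comm]
      simpa using h3
    refine h2.trans ?_
    rw [setLIntegral_iUnion_of_directed _ hmono.directed_le]
    exact iSup_le fun n => maximal hact hf hcm hf1 hμ n
  have hL : Tendsto (fun n : ℕ => ∫⁻ x, f x ∂μ + (n : ℝ≥0∞)⁻¹ * μ univ) atTop
      (nhds (∫⁻ x, f x ∂μ + 0 * μ univ)) :=
    tendsto_const_nhds.add (ENNReal.Tendsto.mul_const ENNReal.tendsto_inv_nat_nhds_zero
      (Or.inr (measure_ne_top _ _)))
  have := ge_of_tendsto' hL fun n => key _ (by simp)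
  simpa using this

lemma Ssum_compl {f f' : X → ℝ≥0∞} (h : ∀ x, f x + f' x = 1) :
    ∀ n x, Ssum p f n x + Ssum p f' n x = n
  | 0, x => by simp [Ssum]
  | n + 1, x => by
    have : Pop p (Ssum p f n) x + Pop p (Ssum p f' n) x = n := by
      rw [← Pop_add]; simp [Ssum_compl h n, Pop]
    simp only [Ssum]
    rw [add_add_add_comm, this, h]; push_cast; ring

lemma Gfun_compl {f f' : X → ℝ≥0∞} (h : ∀ x, f x + f' x = 1) (x : X) :
    1 ≤ Gfun p f x + Gfun p f' x := by
  have h1 : ∀ n, avg p f n x + avg p f' n x = 1 := fun n => by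
    unfold avg
    rw [← ENNReal.add_div, Ssum_compl h]
    push_cast
    exact ENNReal.div_self (by simp) (by finiteness)
  have h2 : 1 ≤ gfun p f x + gfun p f' x := by
    refine le_trans ?_ (limsup_add_le_enn _ _)
    simp [h1]
  have h3 : ∀ f : X → ℝ≥0∞, gfun p f x ≤ Gfun p f x := fun f => by
    have := le_iSup (fun γ : Γ => gfun p f (γ • x)) 1
    rw [one_smul] at this
    exact this
  exact h2.trans (add_le_add (h3 f) (h3 f'))

lemma Gfun_int (hact : ∀ γ : Γ, Measurable (fun x : X => γ • x))
    (hp : ∀ γ : Γ, p {γ} ≠ 0) {B : Set X} (hB : MeasurableSet B)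
    {μ : Measure X} [IsFiniteMeasure μ]
    (hμ : IsInvariantMeasure Γ μ) : ∫⁻ x, Gfun p (B.indicator 1) x ∂μ = μ B := by
  have hm : ∀ {B : Set X}, MeasurableSet B → Measurable (B.indicator (1 : X → ℝ≥0∞)) :=
    fun h => measurable_one.indicator h
  have hl : ∀ (B : Set X) x, B.indicator (1 : X → ℝ≥0∞) x ≤ 1 := fun B x => by
    by_cases h : x ∈ B <;> simp [h]
  have hle : ∀ {B : Set X}, MeasurableSet B → ∫⁻ x, Gfun p (B.indicator 1) x ∂μ ≤ μ B :=
    fun {B} h => (Gfun_int_le hact hp (hm h) (hl B) hμ).trans (by rw [lintegral_indicator_one h])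
  refine le_antisymm (hle hB) ?_
  have hc : ∀ x, B.indicator (1 : X → ℝ≥0∞) x + Bᶜ.indicator (1 : X → ℝ≥0∞) x = 1 := fun x => by
    by_cases h : x ∈ B <;> simp [h]
  have h1 : μ B + μ Bᶜ ≤ ∫⁻ x, Gfun p (B.indicator 1) x ∂μ + μ Bᶜ := by
    rw [measure_add_measure_compl hB]
    calc μ univ = ∫⁻ x, 1 ∂μ := by simp
      _ ≤ ∫⁻ x, (Gfun p (B.indicator 1) x + Gfun p (Bᶜ.indicator 1) x) ∂μ :=
        lintegral_mono fun x => Gfun_compl hc x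
      _ ≤ _ := by
        rw [lintegral_add_left (Gfun_meas hact (hm hB))]
        exact add_le_add le_rfl (hle hB.compl)
  exact (ENNReal.add_le_add_iff_right (measure_ne_top _ _)).1 h1

end Op

lemma exists_G (Γ : Type*) [Group Γ] [Countable Γ] (X : Type*) [MeasurableSpace X]
    [MulAction Γ X] (hact : ∀ γ : Γ, Measurable (fun x : X => γ • x)) :
    ∃ G : Set X → X → ℝ≥0∞, ∀ B, MeasurableSet B → Measurable (G B) ∧
      (∀ (γ : Γ) x, G B (γ • x) = G B x) ∧
      ∀ μ : Measure X, IsFiniteMeasure μ → IsInvariantMeasure Γ μ → ∫⁻ x, G B x ∂μ = μ B := by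
  letI : MeasurableSpace Γ := ⊤
  haveI : DiscreteMeasurableSpace Γ := ⟨fun _ => trivial⟩
  let p : Measure Γ := (Measure.count : Measure Γ).toFinite
  haveI : IsProbabilityMeasure p := by
    haveI : NeZero (Measure.count : Measure Γ) := ⟨by simp⟩
    infer_instance
  have hp : ∀ γ : Γ, p {γ} ≠ 0 := fun γ h => by
    have := absolutelyContinuous_toFinite (Measure.count : Measure Γ) h
    simp at this
  exact ⟨fun B => Gfun p (B.indicator 1), fun B hB =>
    ⟨Gfun_meas hact (measurable_one.indicator hB), Gfun_inv _,
      fun μ hf hμ => Gfun_int hact hp hB hμ⟩⟩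

open ProbabilityTheory

lemma exists_K (X : Type*) [MeasurableSpace X] [StandardBorelSpace X] :
    ∃ (B : ℚ → Set X) (K : (ℚ → ℝ≥0∞) → Measure X), (∀ q, MeasurableSet (B q)) ∧
      Measurable K ∧ ∀ ν : Measure X, IsProbabilityMeasure ν → K (fun q => ν (B q)) = ν := by
  let e := embeddingReal X
  have he : MeasurableEmbedding e := measurableEmbedding_embeddingReal X
  let T : (ℚ → ℝ≥0∞) → ℚ → ℝ := fun a q => (a q).toReal
  have hT : Measurable T := measurable_pi_lambda _ fun q => (measurable_pi_apply q).ennreal_toReal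
  refine ⟨fun q => e ⁻¹' Iic (q : ℝ),
    fun a => (stieltjesOfMeasurableRat T hT a).measure.comap e,
    fun q => he.measurable measurableSet_Iic, ?_, ?_⟩
  · refine Measure.measurable_of_measurable_coe _ fun A hA => ?_
    simp_rw [he.comap_apply]
    exact (Measure.measurable_coe (he.measurableSet_image.2 hA)).comp
      (measurable_measure_stieltjesOfMeasurableRat hT)
  · intro ν hν
    have : IsProbabilityMeasure (ν.map e) := Measure.isProbabilityMeasure_map he.measurable.aemeasurable
    set a : ℚ → ℝ≥0∞ := fun q => ν (e ⁻¹' Iic (q : ℝ)) with ha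
    have hTa : ∀ q : ℚ, T a q = cdf (ν.map e) q := fun q => by
      rw [cdf_eq_real, measureReal_def, Measure.map_apply he.measurable measurableSet_Iic]
    have hpt : IsRatStieltjesPoint T a := by
      have hfun : T a = fun q : ℚ => cdf (ν.map e) q := funext hTa
      refine ⟨?_, ?_, ?_, ?_⟩
      · rw [hfun]
        exact fun q r h => monotone_cdf _ (by exact_mod_cast h)
      · rw [hfun]
        exact (tendsto_cdf_atTop _).comp (tendsto_ratCast_atTop_iff.2 tendsto_id)
      · rw [hfun]
        exact (tendsto_cdf_atBot _).comp (tendsto_ratCast_atBot_iff.2 tendsto_id)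
      · intro t
        simp_rw [hTa]
        rw [← (cdf (ν.map e)).iInf_rat_gt_eq (t : ℝ)]
        exact (Equiv.subtypeEquivRight (p := fun r : ℚ => r ∈ Ioi t)
          (q := fun r : ℚ => (t : ℝ) < r) (by simp)).iInf_congr fun _ => rfl
    have hm : (stieltjesOfMeasurableRat T hT a).measure = ν.map e := by
      rw [← measure_cdf (ν.map e)]
      congr 1
      ext x
      rw [← StieltjesFunction.iInf_rat_gt_eq, ← StieltjesFunction.iInf_rat_gt_eq]
      congr 1
      funext r
      rw [stieltjesOfMeasurableRat_eq, toRatCDF_of_isRatStieltjesPoint hpt, hTa]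
    change (stieltjesOfMeasurableRat T hT a).measure.comap e = ν
    rw [hm, he.comap_map]

section Inv
variable (Γ : Type*) {X : Type*} [Group Γ] [Countable Γ] [mX : MeasurableSpace X] [MulAction Γ X]

/-- the sigma-algebra of invariant measurable sets -/
def invS : MeasurableSpace X where
  MeasurableSet' A := MeasurableSet A ∧ ∀ γ : Γ, (fun x : X => γ • x) ⁻¹' A = A
  measurableSet_empty := ⟨MeasurableSet.empty, fun _ => rfl⟩
  measurableSet_compl A hA := ⟨hA.1.compl, fun γ => by rw [preimage_compl, hA.2]⟩
  measurableSet_iUnion f hf := ⟨MeasurableSet.iUnion fun i => (hf i).1, fun γ => by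
    rw [preimage_iUnion]; simp_rw [(hf _).2]⟩

lemma invS_le : invS Γ ≤ mX := fun _ h => h.1

variable {Γ}

lemma invS_meas {Y : Type*} [MeasurableSpace Y] {u : X → Y} (hu : Measurable u)
    (hi : ∀ (γ : Γ) x, u (γ • x) = u x) : Measurable[invS Γ] u := fun s hs =>
  ⟨hu hs, fun γ => by ext x; simp [hi]⟩

lemma image_iff {A : Set X} (h : ∀ γ : Γ, (fun x : X => γ • x) '' A = A) (γ : Γ) :
    (fun x : X => γ • x) ⁻¹' A = A := by
  ext x
  constructor
  · intro hx
    rw [← h γ⁻¹]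
    exact ⟨γ • x, hx, by simp⟩
  · intro hx
    change γ • x ∈ A
    rw [← h γ]
    exact ⟨x, hx, rfl⟩

lemma image_of_pre {A : Set X} (h : ∀ γ : Γ, (fun x : X => γ • x) ⁻¹' A = A) (γ : Γ) :
    (fun x : X => γ • x) '' A = A := by
  conv_rhs => rw [← h γ⁻¹]
  ext x
  constructor
  · rintro ⟨y, hy, rfl⟩
    simpa using hy
  · intro hx
    exact ⟨γ⁻¹ • x, hx, by simp⟩

lemma ae_eq_inv {μ : Measure X} [IsFiniteMeasure μ] {u v : X → ℝ≥0∞}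
    (hu : Measurable[invS Γ] u) (hv : Measurable[invS Γ] v)
    (h : ∀ C, MeasurableSet[invS Γ] C → ∫⁻ x in C, u x ∂μ = ∫⁻ x in C, v x ∂μ) : u =ᵐ[μ] v := by
  refine ae_eq_of_ae_eq_trim (hm := invS_le Γ) ?_
  refine ae_eq_of_forall_setLIntegral_eq_of_sigmaFinite hu hv fun C hC _ => ?_
  rw [restrict_trim _ _ hC, lintegral_trim _ hu, lintegral_trim _ hv, h C hC]

lemma restrict_inv (hact : ∀ γ : Γ, Measurable (fun x : X => γ • x)) {μ : Measure X}
    (hμ : IsInvariantMeasure Γ μ) {C : Set X} (hC : MeasurableSet[invS Γ] C) :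
    IsInvariantMeasure Γ (μ.restrict C) := fun γ => by
  have := Measure.restrict_map (μ := μ) (hact γ) hC.1
  rw [hμ γ, hC.2 γ] at this
  exact this.symm

lemma condK_int [StandardBorelSpace X] {μ : Measure X} [IsFiniteMeasure μ] {C A : Set X}
    (hC : MeasurableSet[invS Γ] C) (hA : MeasurableSet A) :
    ∫⁻ x in C, condExpKernel μ (invS Γ) x A ∂μ = μ (A ∩ C) := by
  have h := compProd_trim_condExpKernel (μ := μ) (invS_le (X := X) Γ)
  have hd : @Measurable X (X × X) mX (@Prod.instMeasurableSpace _ _ (invS Γ) mX)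
      Function.diag := by
    refine @Measurable.prodMk X mX X X (invS Γ) mX _ _ ?_ ?_
    · exact measurable_id'' (invS_le Γ)
    · exact measurable_id
  have h2 := congrArg (fun m => m (C ×ˢ A)) h
  beta_reduce at h2
  rw [Measure.compProd_apply_prod hC hA, Measure.map_apply
    hd
    (@MeasurableSet.prod _ _ (invS Γ) mX _ _ hC hA), restrict_trim _ _ hC,
    lintegral_trim _ (measurable_condExpKernel hA)] at h2
  rw [h2]
  congr 1
  ext x
  simp [and_comm]

end Inv

lemma exists_base (Γ : Type*) [Group Γ] [Countable Γ] (X : Type*) [MeasurableSpace X]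
    [StandardBorelSpace X] [MulAction Γ X] (hact : ∀ γ : Γ, Measurable (fun x : X => γ • x)) :
    ∃ (B : ℚ → Set X) (b : X → Measure X), (∀ q, MeasurableSet (B q)) ∧ Measurable b ∧
      (∀ (γ : Γ) x, b (γ • x) = b x) ∧
      (∀ ν ν' : Measure X, IsProbabilityMeasure ν → IsProbabilityMeasure ν' →
        (∀ q, ν (B q) = ν' (B q)) → ν = ν') ∧
      ∀ μ : Measure X, IsProbabilityMeasure μ → IsInvariantMeasure Γ μ →
        (∀ᵐ x ∂μ, IsProbabilityMeasure (b x)) ∧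
        ∀ A C : Set X, MeasurableSet A → MeasurableSet[invS Γ] C →
          ∫⁻ x in C, b x A ∂μ = μ (A ∩ C) := by
  obtain ⟨G, hG⟩ := exists_G Γ X hact
  obtain ⟨B, K, hB, hK, hKν⟩ := exists_K X
  refine ⟨B, fun x => K (fun q => G (B q) x), hB,
    hK.comp (measurable_pi_lambda _ fun q => (hG (B q) (hB q)).1), ?_, ?_, ?_⟩
  · intro γ x
    exact congrArg K (funext fun q => (hG (B q) (hB q)).2.1 γ x)
  · intro ν ν' h1 h2 h
    rw [← hKν ν h1, ← hKν ν' h2]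
    exact congrArg K (funext h)
  · intro μ hμ hinv
    have : Nonempty X := nonempty_of_isProbabilityMeasure μ
    have h1 : ∀ᵐ x ∂μ, ∀ q, G (B q) x = condExpKernel μ (invS Γ) x (B q) := by
      rw [ae_all_iff]
      intro q
      refine ae_eq_inv (Γ := Γ) (invS_meas (hG _ (hB q)).1 (hG _ (hB q)).2.1)
        (measurable_condExpKernel (hB q)) fun C hC => ?_
      rw [condK_int hC (hB q), (hG _ (hB q)).2.2 _ inferInstance (restrict_inv hact hinv hC),
        Measure.restrict_apply (hB q)]
    have h2 : ∀ᵐ x ∂μ, K (fun q => G (B q) x) = condExpKernel μ (invS Γ) x := by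
      filter_upwards [h1] with x hx
      rw [← hKν (condExpKernel μ (invS Γ) x) inferInstance]
      exact congrArg K (funext hx)
    constructor
    · filter_upwards [h2] with x hx
      rw [hx]; infer_instance
    · intro A C hA hC
      rw [← condK_int hC hA]
      refine lintegral_congr_ae (ae_restrict_of_ae ?_)
      filter_upwards [h2] with x hx
      rw [hx]

section Main
variable {Γ : Type*} [Group Γ] [Countable Γ] {X : Type*} [MeasurableSpace X]
    [StandardBorelSpace X] [MulAction Γ X]

lemma ind_ae {μ : Measure X} [IsProbabilityMeasure μ] {b : X → Measure X} (hb : Measurable b)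
    (hbi : ∀ (γ : Γ) x, b (γ • x) = b x)
    (hint : ∀ A C : Set X, MeasurableSet A → MeasurableSet[invS Γ] C →
          ∫⁻ x in C, b x A ∂μ = μ (A ∩ C)) {A : Set X} (hA : MeasurableSet[invS Γ] A) :
    ∀ᵐ x ∂μ, b x A = A.indicator 1 x := by
  refine ae_eq_inv (Γ := Γ) (invS_meas ((Measure.measurable_coe hA.1).comp hb)
    fun γ x => by simp [hbi]) (Measurable.indicator (@measurable_one _ _ _ (invS Γ) _) hA) fun C hC => ?_
  rw [hint A C hA.1 hC, lintegral_indicator_one hA.1, Measure.restrict_apply hA.1]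

lemma tinv_ae (hact : ∀ γ : Γ, Measurable (fun x : X => γ • x))
    {μ : Measure X} [IsProbabilityMeasure μ] (hμ : IsInvariantMeasure Γ μ)
    {b : X → Measure X} (hb : Measurable b)
    (hbi : ∀ (γ : Γ) x, b (γ • x) = b x)
    (hint : ∀ A C : Set X, MeasurableSet A → MeasurableSet[invS Γ] C →
          ∫⁻ x in C, b x A ∂μ = μ (A ∩ C)) {A : Set X} (hA : MeasurableSet A) (γ : Γ) :
    ∀ᵐ x ∂μ, b x ((fun x => γ • x) ⁻¹' A) = b x A := by
  have hA' := hact γ hA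
  refine ae_eq_inv (Γ := Γ) (invS_meas ((Measure.measurable_coe hA').comp hb)
    fun γ x => by simp [hbi]) (invS_meas ((Measure.measurable_coe hA).comp hb)
    fun γ x => by simp [hbi]) fun C hC => ?_
  rw [hint A C hA hC, hint _ C hA' hC]
  conv_lhs => rw [← hC.2 γ]
  rw [← preimage_inter, ← Measure.map_apply (hact γ) (hA.inter hC.1), hμ γ]

lemma eq_of_rat {a c : ℝ≥0∞} (h : ∀ r : ℚ, (a < ENNReal.ofReal r ↔ c < ENNReal.ofReal r)) :
    a = c := by
  have key : ∀ a c : ℝ≥0∞, (∀ r : ℚ, (a < ENNReal.ofReal r ↔ c < ENNReal.ofReal r)) → c ≤ a := by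
    intro a c h
    by_contra! hlt
    obtain ⟨r, _, h1, h2⟩ := ENNReal.lt_iff_exists_rat_btwn.1 hlt
    exact absurd ((h r).1 h1) (not_lt.2 h2.le)
  exact le_antisymm (key _ _ fun r => (h r).symm) (key _ _ h)

lemma core (hact : ∀ γ : Γ, Measurable (fun x : X => γ • x))
    (hexists : ∃ μ : Measure X, IsProbabilityMeasure μ ∧ IsInvariantMeasure Γ μ) :
    ∃ β : X → Measure X,
      ∀ μ : Measure X, IsProbabilityMeasure μ → IsInvariantMeasure Γ μ →
        IsErgodicDecomposition Γ μ β := by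
  classical
  obtain ⟨B, b, hB, hb, hbi, hsep, hmain⟩ := exists_base Γ X hact
  have hbA : ∀ A, MeasurableSet A → Measurable fun x => b x A := fun A hA =>
    (Measure.measurable_coe hA).comp hb
  let D : ℚ → ℚ → Set X := fun q r => {y | b y (B q) < ENNReal.ofReal r}
  have hDm : ∀ q r, MeasurableSet (D q r) := fun q r =>
    measurableSet_lt (hbA _ (hB q)) measurable_const
  have hD : ∀ q r, MeasurableSet[invS Γ] (D q r) := fun q r =>
    ⟨hDm q r, fun γ => by ext x; simp [D, hbi]⟩
  let E : Set X := {x | b x univ = 1 ∧ (∀ (γ : Γ) q, b x ((fun x => γ • x) ⁻¹' (B q)) = b x (B q)) ∧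
    ∀ q r, b x (D q r) = (D q r).indicator 1 x}
  have hEm : MeasurableSet E := by
    refine MeasurableSet.inter (measurableSet_eq_fun (hbA _ .univ) measurable_const)
      (MeasurableSet.inter ?_ ?_)
    · change MeasurableSet {x | ∀ (γ : Γ) q, b x ((fun x => γ • x) ⁻¹' (B q)) = b x (B q)}
      simp only [ofPred_forall]
      exact MeasurableSet.iInter fun γ => MeasurableSet.iInter fun q =>
        measurableSet_eq_fun (hbA _ (hact γ (hB q))) (hbA _ (hB q))
    · change MeasurableSet {x | ∀ q r, b x (D q r) = (D q r).indicator 1 x}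
      simp only [ofPred_forall]
      exact MeasurableSet.iInter fun q => MeasurableSet.iInter fun r =>
        measurableSet_eq_fun (hbA _ (hDm q r)) (measurable_one.indicator (hDm q r))
  have hEi : ∀ (γ : Γ) x, γ • x ∈ E ↔ x ∈ E := by
    intro γ x
    have : ∀ q r, (D q r).indicator (1 : X → ℝ≥0∞) (γ • x) = (D q r).indicator 1 x := by
      intro q r
      simp [indicator, D, hbi]
    simp only [E, mem_ofPred_eq, hbi, this]
  have hEae : ∀ μ : Measure X, IsProbabilityMeasure μ → IsInvariantMeasure Γ μ →
      ∀ᵐ x ∂μ, x ∈ E := by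
    intro μ h1 h2
    obtain ⟨h3, h4⟩ := hmain μ h1 h2
    have h5 : ∀ᵐ x ∂μ, ∀ (γ : Γ) q, b x ((fun x => γ • x) ⁻¹' (B q)) = b x (B q) := by
      simp only [ae_all_iff]
      exact fun γ q => tinv_ae hact h2 hb hbi h4 (hB q) γ
    have h6 : ∀ᵐ x ∂μ, ∀ q r, b x (D q r) = (D q r).indicator 1 x := by
      simp only [ae_all_iff]
      exact fun q r => ind_ae hb hbi h4 (hD q r)
    filter_upwards [h3, h5, h6] with x hx1 hx2 hx3
    exact ⟨measure_univ, hx2, hx3⟩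
  have hErg : ∀ x ∈ E, IsErgodicInvariantProb Γ (b x) := by
    rintro x ⟨hx1, hx2, hx3⟩
    have hp : IsProbabilityMeasure (b x) := ⟨hx1⟩
    have hi : IsInvariantMeasure Γ (b x) := fun γ => by
      refine hsep _ _ (Measure.isProbabilityMeasure_map (hact γ).aemeasurable) hp fun q => ?_
      rw [Measure.map_apply (hact γ) (hB q), hx2]
    refine ⟨hp, hi, fun A hA hAi => ?_⟩
    obtain ⟨h3, h4⟩ := hmain _ hp hi
    have hA' : MeasurableSet[invS Γ] A := ⟨hA, image_iff hAi⟩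
    have h7 := ind_ae hb hbi h4 hA'
    have h8 : ∀ᵐ y ∂(b x), ∀ q r, (y ∈ D q r ↔ x ∈ D q r) := by
      simp only [ae_all_iff]
      intro q r
      have := hx3 q r
      by_cases hxD : x ∈ D q r
      · rw [indicator_of_mem hxD, Pi.one_apply] at this
        filter_upwards [(mem_ae_iff_prob_eq_one (hDm q r)).2 this] with y hy
        exact ⟨fun _ => hxD, fun _ => hy⟩
      · rw [indicator_of_notMem hxD] at this
        filter_upwards [measure_eq_zero_iff_ae_notMem.1 this] with y hy
        exact ⟨fun h => absurd h hy, fun h => absurd h hxD⟩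
    obtain ⟨y, hy1, hy2, hy3⟩ := (h3.and (h7.and h8)).exists
    have hyx : b y = b x := hsep _ _ hy1 hp fun q => eq_of_rat fun r => hy3 q r
    rw [hyx] at hy2
    by_cases hyA : y ∈ A
    · right; simpa [hyA] using hy2
    · left; simpa [hyA] using hy2
  obtain ⟨μ₀, hμ₀, hμ₀i⟩ := hexists
  obtain ⟨x₀, hx₀⟩ := (hEae μ₀ hμ₀ hμ₀i).exists
  let β : X → Measure X := fun x => if x ∈ E then b x else b x₀
  have hβE : ∀ x ∈ E, β x = b x := fun x hx => if_pos hx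
  have hβerg : ∀ x, IsErgodicInvariantProb Γ (β x) := by
    intro x
    by_cases hx : x ∈ E
    · rw [hβE x hx]; exact hErg x hx
    · have : β x = b x₀ := if_neg hx
      rw [this]; exact hErg x₀ hx₀
  have hβm : Measurable β := Measurable.ite hEm hb measurable_const
  refine ⟨β, fun μ h1 h2 => ⟨hβerg, fun A hA => (Measure.measurable_coe hA).comp hβm, ?_, ?_, ?_⟩⟩
  · intro A hA
    have := (hmain μ h1 h2).2 A univ hA (@MeasurableSet.univ _ (invS Γ))
    rw [Measure.restrict_univ, inter_univ] at this
    rw [← this]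
    refine lintegral_congr_ae ?_
    filter_upwards [hEae μ h1 h2] with x hx
    rw [hβE x hx]
  · intro x γ
    simp only [β, hEi, hbi]
  · intro ν hν
    have hνp : IsProbabilityMeasure ν := hν.1
    have hset : {x | β x = ν} = {x | ∀ q, β x (B q) = ν (B q)} := by
      ext x
      exact ⟨fun h q => by rw [show β x = ν from h], fun h => hsep _ _ (hβerg x).1 hν.1 h⟩
    have hm : MeasurableSet {x | β x = ν} := by
      rw [hset]
      simp only [ofPred_forall]
      exact MeasurableSet.iInter fun q =>
        measurableSet_eq_fun ((Measure.measurable_coe (hB q)).comp hβm) measurable_const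
    refine ⟨hm, (mem_ae_iff_prob_eq_one hm).1 ?_⟩
    rw [hset]
    have h4 := (hmain ν hν.1 hν.2.1).2
    have h5 : ∀ᵐ x ∂ν, ∀ q, b x (B q) = ν (B q) := by
      rw [ae_all_iff]
      intro q
      refine ae_eq_inv (Γ := Γ) (invS_meas (hbA _ (hB q)) fun γ x => by simp [hbi])
        (@measurable_const _ _ _ (invS Γ) _) fun C hC => ?_
      rw [h4 _ C (hB q) hC, setLIntegral_const]
      rcases hν.2.2 C hC.1 (image_of_pre hC.2) with h | h
      · rw [h, mul_zero]
        exact measure_mono_null inter_subset_right h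
      · rw [h, mul_one]
        exact measure_inter_conull' (by
          rw [sdiff_eq]
          exact measure_mono_null inter_subset_right ((prob_compl_eq_zero_iff hC.1).2 h))
    filter_upwards [h5, hEae ν hν.1 hν.2.1] with x hx hxE q
    rw [hβE x hxE, hx q]

end Main

end ErgDec
/-- (Ergodic decomposition theorem.) If a standard action of a
countable group `Γ` on a standard Borel space `X` admits at least one invariant
probability measure, then there is a single map `β : X → Erg(α)` that is an ergodic
decomposition of `(α, μ)` simultaneously for every `α`-invariant probability
measure `μ` on `X`. -/
theorem exists_universal_ergodicDecomposition
    (Γ : Type*) [Group Γ] [Countable Γ]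
    (X : Type*) [MeasurableSpace X] [StandardBorelSpace X]
    [MulAction Γ X] (hact : ∀ γ : Γ, Measurable (fun x : X => γ • x))
    (hexists : ∃ μ : Measure X, IsProbabilityMeasure μ ∧ IsInvariantMeasure Γ μ) :
    ∃ β : X → Measure X,
      ∀ μ : Measure X, IsProbabilityMeasure μ → IsInvariantMeasure Γ μ →
        IsErgodicDecomposition Γ μ β := by
  exact ErgDec.core hact hexists
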